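/- Let p > 1, q = p/(p−1), ν < 1, and let f be measurable on (0,∞) with ‖f‖_{ν,p} < ∞. Then for every τ ≥ 0 the integral (F f)(τ) = ∫_0^∞ 𝒦(x,τ)·f(x) dx converges absolutely, the function F f is continuous and bounded on [0,∞), and sup_{τ ≥ 0} |(F f)(τ)| ≤ 4^{ν−3+1/q}·q^{4(ν−1)}·Γ(4(1−ν)q)^{1/q}·B(1−ν, 1−ν)·B(2(1−ν), 2(1−ν))·‖f‖_{ν,p}, where Γ is Euler's gamma function and B(a,b) = Γ(a)Γ(b)/Γ(a+b) is the beta function. -/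

import Mathlib

open MeasureTheory Set Filter Asymptotics

/-- Modified Bessel function of the second kind (integral representation, for Re z > 0). -/
noncomputable def besselK (nu z : ℂ) : ℂ :=
  ∫ t in Set.Ioi (0:ℝ), Complex.exp (-z * (Real.cosh t : ℂ)) * Complex.cosh (nu * (t : ℂ))

/-- The kernel 𝒦(x,τ) = ker²_{2iτ}(2(4x)^{1/4}) + kei²_{2iτ}(2(4x)^{1/4})
    = K_{2iτ}(2(4x)^{1/4}e^{iπ/4}) · K_{2iτ}(2(4x)^{1/4}e^{-iπ/4}), which is real. -/
noncomputable def kernelK (x τ : ℝ) : ℝ :=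
  (besselK (2 * Complex.I * (τ:ℂ))
      (((2 * (4*x) ^ ((1:ℝ)/4) : ℝ) : ℂ) * Complex.exp (Complex.I * (Real.pi:ℂ) / 4)) *
   besselK (2 * Complex.I * (τ:ℂ))
      (((2 * (4*x) ^ ((1:ℝ)/4) : ℝ) : ℂ) * Complex.exp (-(Complex.I * (Real.pi:ℂ)) / 4))).re

/-- K₀(y) = ∫₀^∞ exp(−y·cosh t) dt. -/
noncomputable def besselK0 (y : ℝ) : ℝ := ∫ t in Set.Ioi (0:ℝ), Real.exp (-y * Real.cosh t)

/-- K_{iτ}(x) = ∫₀^∞ exp(−x·cosh t)·cos(τt) dt (real-valued, purely imaginary order). -/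
noncomputable def besselKi (τ x : ℝ) : ℝ :=
  ∫ t in Set.Ioi (0:ℝ), Real.exp (-x * Real.cosh t) * Real.cos (τ * t)

/-- Modified Bessel function of the first kind I_ν(z) (power series). -/
noncomputable def besselI (nu z : ℂ) : ℂ :=
  ∑' n : ℕ, (z/2) ^ (nu + 2*(n:ℂ)) / ((n.factorial : ℂ) * Complex.Gamma (nu + (n:ℂ) + 1))

/-- B_ν(w) = ber²_ν(w) + bei²_ν(w) = I_ν(w·e^{iπ/4})·I_ν(w·e^{−iπ/4}). -/
noncomputable def kelvinB (nu w : ℂ) : ℂ :=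
  besselI nu (w * Complex.exp (Complex.I * (Real.pi:ℂ) / 4)) *
  besselI nu (w * Complex.exp (-(Complex.I * (Real.pi:ℂ)) / 4))

/-- Index transform (1.1): (F f)(τ) = ∫₀^∞ 𝒦(x,τ) f(x) dx. -/
noncomputable def indexF (f : ℝ → ℝ) (τ : ℝ) : ℝ := ∫ x in Set.Ioi (0:ℝ), kernelK x τ * f x

/-- Index transform (1.2): (G g)(x) = ∫₀^∞ 𝒦(x,τ) g(τ) dτ. -/
noncomputable def indexG (g : ℝ → ℝ) (x : ℝ) : ℝ := ∫ τ in Set.Ioi (0:ℝ), kernelK x τ * g τ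

/-- Index transform (1.2) for complex-valued densities. -/
noncomputable def indexGC (g : ℝ → ℂ) (x : ℝ) : ℂ :=
  ∫ τ in Set.Ioi (0:ℝ), (kernelK x τ : ℂ) * g τ

/-- Mellin transform of a real function. -/
noncomputable def mellinT (f : ℝ → ℝ) (s : ℂ) : ℂ :=
  ∫ x in Set.Ioi (0:ℝ), (f x : ℂ) * (x:ℂ) ^ (s - 1)

/-- Mellin transform of a complex function. -/
noncomputable def mellinC (F : ℝ → ℂ) (s : ℂ) : ℂ :=
  ∫ x in Set.Ioi (0:ℝ), F x * (x:ℂ) ^ (s - 1)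

/-- The L_{ν,p}(ℝ₊) norm. -/
noncomputable def Lnorm (ν p : ℝ) (f : ℝ → ℝ) : ℝ :=
  (∫ x in Set.Ioi (0:ℝ), |f x| ^ p * x ^ (ν*p - 1)) ^ (1/p)

/-- Euler beta function B(a,b) = Γ(a)Γ(b)/Γ(a+b). -/
noncomputable def betaFn (a b : ℝ) : ℝ := Real.Gamma a * Real.Gamma b / Real.Gamma (a+b)

lemma sq_div_four_le_cosh (t : ℝ) : t ^ 2 / 4 ≤ Real.cosh t := by
  rw [← Real.cosh_abs, Real.cosh_eq]
  have h := Real.quadratic_le_exp_of_nonneg (abs_nonneg t)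
  rw [sq_abs] at h
  linarith [abs_nonneg t, Real.exp_pos (-|t|)]

lemma integrable_exp_neg_mul_cosh {c : ℝ} (hc : 0 < c) :
    Integrable (fun t : ℝ => Real.exp (-c * Real.cosh t)) := by
  refine (integrable_exp_neg_mul_sq (b := c / 4) (by positivity)).mono'
    (by fun_prop) (Eventually.of_forall fun t => ?_)
  rw [Real.norm_of_nonneg (Real.exp_pos _).le]
  rw [Real.exp_le_exp]
  nlinarith [sq_div_four_le_cosh t]

lemma integrable_cosh_mul_exp_neg_mul_cosh {c : ℝ} (hc : 0 < c) :
    Integrable (fun t : ℝ => Real.cosh t * Real.exp (-c * Real.cosh t)) := by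
  refine ((integrable_exp_neg_mul_cosh (half_pos hc)).const_mul (2 / c)).mono'
    (by fun_prop) (Eventually.of_forall fun t => ?_)
  rw [Real.norm_of_nonneg (by positivity)]
  have h : c / 2 * Real.cosh t ≤ Real.exp (c / 2 * Real.cosh t) := by
    linarith [Real.add_one_le_exp (c / 2 * Real.cosh t)]
  have h2 : Real.exp (-c * Real.cosh t)
      = Real.exp (-(c / 2 * Real.cosh t)) * Real.exp (-(c / 2) * Real.cosh t) := by
    rw [← Real.exp_add]; ring_nf
  have h3 : c / 2 * Real.cosh t * Real.exp (-(c / 2 * Real.cosh t)) ≤ 1 := by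
    rw [Real.exp_neg, ← div_eq_mul_inv, div_le_one (Real.exp_pos _)]; exact h
  have h4 : Real.cosh t * Real.exp (-(c / 2 * Real.cosh t)) ≤ 2 / c := by
    rw [le_div_iff₀ hc]; linarith
  rw [h2, ← mul_assoc]
  gcongr

lemma norm_sinh_add_mul_I_le (v φ : ℝ) :
    ‖Complex.sinh (v + φ * Complex.I)‖ ≤ Real.cosh v := by
  rw [Complex.sinh, norm_div, Complex.norm_two, Real.cosh_eq]
  gcongr
  refine (norm_sub_le _ _).trans ?_
  simp [Complex.norm_exp]

lemma cosh_add_mul_I_eq (v φ : ℝ) :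
    Complex.cosh (v + φ * Complex.I) =
      (Real.cosh v * Real.cos φ : ℝ) + (Real.sinh v * Real.sin φ : ℝ) * Complex.I := by
  rw [Complex.cosh_add, Complex.cosh_mul_I, Complex.sinh_mul_I]
  push_cast
  ring

lemma norm_exp_neg_mul_cosh_add_mul_I (c v φ : ℝ) :
    ‖Complex.exp (-c * Complex.cosh (v + φ * Complex.I))‖ =
      Real.exp (-(c * Real.cos φ) * Real.cosh v) := by
  rw [Complex.norm_exp, cosh_add_mul_I_eq]
  congr 1
  simp [-Complex.ofReal_mul]
  ring

lemma hasDerivAt_integral_exp_neg_mul_cosh {c : ℝ} (hc : 0 < c) {φ₀ : ℝ} (h₀ : 0 < Real.cos φ₀) :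
    HasDerivAt (fun φ : ℝ => ∫ v : ℝ, Complex.exp (-c * Complex.cosh (v + φ * Complex.I))) 0 φ₀ := by
  have hint : ∀ φ : ℝ, 0 < Real.cos φ →
      Integrable (fun v : ℝ => Complex.exp (-c * Complex.cosh (v + φ * Complex.I))) := by
    intro φ hφ
    refine (integrable_exp_neg_mul_cosh (mul_pos hc hφ)).mono' ?_
      (Eventually.of_forall fun v => (norm_exp_neg_mul_cosh_add_mul_I c v φ).le)
    exact Continuous.aestronglyMeasurable (by fun_prop)
  have hG : ∀ w : ℂ, HasDerivAt (fun w : ℂ => Complex.exp (-c * Complex.cosh w))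
      (Complex.exp (-c * Complex.cosh w) * (-c * Complex.sinh w)) w :=
    fun w => ((Complex.hasDerivAt_cosh w).const_mul (-c : ℂ)).cexp
  have hs : {φ : ℝ | Real.cos φ₀ / 2 < Real.cos φ} ∈ nhds φ₀ :=
    (isOpen_lt continuous_const Real.continuous_cos).mem_nhds (by simpa using h₀)
  have key := hasDerivAt_integral_of_dominated_loc_of_deriv_le (μ := volume)
    (F := fun (φ v : ℝ) => Complex.exp (-c * Complex.cosh (v + φ * Complex.I)))
    (F' := fun (φ v : ℝ) => Complex.exp (-c * Complex.cosh (v + φ * Complex.I)) *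
      (-c * (Complex.sinh (v + φ * Complex.I) * Complex.I)))
    (bound := fun v => c * (Real.cosh v * Real.exp (-(c * (Real.cos φ₀ / 2)) * Real.cosh v)))
    (x₀ := φ₀) hs
    (Eventually.of_forall fun φ => Continuous.aestronglyMeasurable (by fun_prop))
    (hint φ₀ h₀)
    (Continuous.aestronglyMeasurable (by fun_prop))
    (Eventually.of_forall fun v φ hφ => ?_)
    ((integrable_cosh_mul_exp_neg_mul_cosh (by positivity)).const_mul c)
    (Eventually.of_forall fun v φ hφ => ?_)
  · have hzero : ∫ v : ℝ, Complex.exp (-c * Complex.cosh (v + φ₀ * Complex.I)) *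
      (-c * (Complex.sinh (v + φ₀ * Complex.I) * Complex.I)) = 0 := by
      refine integral_eq_zero_of_hasDerivAt_of_integrable
        (f := fun v : ℝ => Complex.exp (-c * Complex.cosh (v + φ₀ * Complex.I)) * Complex.I)
        (fun v => ?_) key.1 ((hint φ₀ h₀).mul_const _)
      have h1 : HasDerivAt (fun v : ℝ => (v : ℂ) + φ₀ * Complex.I) 1 v :=
        (Complex.ofRealCLM.hasDerivAt (x := v)).add_const _
      convert! ((hG (v + φ₀ * Complex.I)).scomp v h1).mul_const Complex.I using 1
      simp only [smul_eq_mul]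
      ring
    rw [← hzero]
    exact key.2
  · have hφ' : Real.cos φ₀ / 2 < Real.cos φ := hφ
    rw [norm_mul, norm_exp_neg_mul_cosh_add_mul_I, norm_mul, norm_mul, Complex.norm_I, norm_neg,
      Complex.norm_real, Real.norm_of_nonneg hc.le, mul_one]
    have h1 := norm_sinh_add_mul_I_le v φ
    calc _ ≤ Real.exp (-(c * (Real.cos φ₀ / 2)) * Real.cosh v) * (c * Real.cosh v) := by
          gcongr
      _ = _ := by ring
  · have h1 : HasDerivAt (fun φ : ℝ => (v : ℂ) + φ * Complex.I) Complex.I φ := by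
      simpa using ((Complex.ofRealCLM.hasDerivAt (x := φ)).mul_const Complex.I).const_add (v : ℂ)
    convert! (hG (v + φ * Complex.I)).scomp φ h1 using 1
    simp only [smul_eq_mul]
    ring

lemma integral_exp_neg_mul_cosh_add_mul_I {c : ℝ} (hc : 0 < c) {φ : ℝ}
    (hφ : φ ∈ Ioo (-(Real.pi / 2)) (Real.pi / 2)) :
    ∫ v : ℝ, Complex.exp (-c * Complex.cosh (v + φ * Complex.I)) =
      ∫ v : ℝ, Complex.exp (-c * Complex.cosh v) := by
  have hd : ∀ ψ ∈ Ioo (-(Real.pi / 2)) (Real.pi / 2), HasDerivAt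
      (fun φ : ℝ => ∫ v : ℝ, Complex.exp (-c * Complex.cosh (v + φ * Complex.I))) 0 ψ :=
    fun ψ hψ => hasDerivAt_integral_exp_neg_mul_cosh hc (Real.cos_pos_of_mem_Ioo hψ)
  have := IsOpen.is_const_of_deriv_eq_zero isOpen_Ioo isPreconnected_Ioo
    (fun ψ hψ => (hd ψ hψ).differentiableAt.differentiableWithinAt)
    (fun ψ hψ => (hd ψ hψ).deriv) hφ
    (show (0 : ℝ) ∈ Ioo (-(Real.pi / 2)) (Real.pi / 2) by constructor <;> linarith [Real.pi_pos])
  simpa using this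

lemma norm_exp_neg_mul_cosh_mul_exp (z : ℂ) (τ t : ℝ) :
    ‖Complex.exp (-z * (Real.cosh t : ℂ)) * Complex.exp (2 * Complex.I * (τ : ℂ) * (t : ℂ))‖ =
      Real.exp (-z.re * Real.cosh t) := by
  rw [norm_mul, Complex.norm_exp, Complex.norm_exp]
  simp

lemma integrable_exp_neg_mul_cosh_mul_exp {z : ℂ} (hz : 0 < z.re) (τ : ℝ) :
    Integrable (fun t : ℝ => Complex.exp (-z * (Real.cosh t : ℂ)) *
      Complex.exp (2 * Complex.I * (τ : ℂ) * (t : ℂ))) :=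
  (integrable_exp_neg_mul_cosh hz).mono' (Continuous.aestronglyMeasurable (by fun_prop))
    (Eventually.of_forall fun t => (norm_exp_neg_mul_cosh_mul_exp z τ t).le)

lemma two_mul_besselK {z : ℂ} (hz : 0 < z.re) (τ : ℝ) :
    2 * besselK (2 * Complex.I * (τ : ℂ)) z = ∫ t : ℝ, Complex.exp (-z * (Real.cosh t : ℂ)) *
      Complex.exp (2 * Complex.I * (τ : ℂ) * (t : ℂ)) := by
  have hi := integrable_exp_neg_mul_cosh_mul_exp hz τ
  have hn := integral_comp_neg_Ioi 0 (fun t : ℝ => Complex.exp (-z * (Real.cosh t : ℂ)) *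
      Complex.exp (2 * Complex.I * (τ : ℂ) * (t : ℂ)))
  rw [neg_zero] at hn
  rw [← intervalIntegral.integral_Iic_add_Ioi (b := 0) hi.integrableOn hi.integrableOn, ← hn,
    ← integral_add hi.comp_neg.integrableOn hi.integrableOn, besselK, ← integral_const_mul]
  congr 1 with t
  rw [Complex.cosh]
  simp only [Real.cosh_neg, Complex.ofReal_neg]
  ring_nf

lemma integral_mul_integral_eq_two_mul {f g : ℝ → ℂ} (hf : Integrable f) (hg : Integrable g)
    (hfc : Continuous f) (hgc : Continuous g) :
    (∫ s, f s) * ∫ t, g t = 2 * ∫ u : ℝ, ∫ v : ℝ, f (u + v) * g (u - v) := by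
  have hsub : ∀ (h : ℝ → ℂ) (s : ℝ), ∫ u : ℝ, h (2 * u - s) = (1 / 2 : ℂ) * ∫ t, h t := by
    intro h s
    have := Measure.integral_comp_mul_left (fun t => h (t - s)) 2
    rw [this, integral_sub_right_eq_self h s]
    simp
  have hsubR : ∀ (h : ℝ → ℝ) (s : ℝ), ∫ u : ℝ, h (2 * u - s) = (1 / 2) * ∫ t, h t := by
    intro h s
    have := Measure.integral_comp_mul_left (fun t => h (t - s)) 2
    rw [this, integral_sub_right_eq_self h s]
    simp
  have hint : Integrable (Function.uncurry fun s u : ℝ => f s * g (2 * u - s))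
      (volume.prod volume) := by
    rw [integrable_prod_iff (Continuous.aestronglyMeasurable (by fun_prop))]
    refine ⟨Eventually.of_forall fun s => ?_, ?_⟩
    · exact ((hg.comp_sub_right s).comp_mul_left' two_ne_zero).const_mul (f s)
    · simp only [Function.uncurry, norm_mul, integral_const_mul]
      simp only [hsubR fun t => ‖g t‖]
      exact hf.norm.mul_const _
  have h1 : ∫ s : ℝ, ∫ u : ℝ, f s * g (2 * u - s) = (1 / 2 : ℂ) * ((∫ s, f s) * ∫ t, g t) := by
    simp only [integral_const_mul, hsub, integral_mul_const]
    ring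
  rw [integral_integral_swap hint] at h1
  have h2 : ∀ u : ℝ, ∫ v : ℝ, f (u + v) * g (u - v) = ∫ s : ℝ, f s * g (2 * u - s) := by
    intro u
    rw [← integral_add_left_eq_self (fun s : ℝ => f s * g (2 * u - s)) u]
    congr 1 with v
    congr 2
    ring
  simp only [h2, h1]
  ring

lemma enorm_integral_exp_neg_le {a : ℝ} (ha : 0 < a) (τ u : ℝ) :
    ‖∫ v : ℝ, (Complex.exp (-(a * (1 + Complex.I)) * (Real.cosh (u + v) : ℂ)) *
        Complex.exp (2 * Complex.I * (τ : ℂ) * ((u + v : ℝ) : ℂ))) *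
      (Complex.exp (-(a * (1 - Complex.I)) * (Real.cosh (u - v) : ℂ)) *
        Complex.exp (2 * Complex.I * (τ : ℂ) * ((u - v : ℝ) : ℂ)))‖ₑ ≤
    ∫⁻ v : ℝ, ENNReal.ofReal (Real.exp (-(2 * a * √(Real.cosh (2 * u))) * Real.cosh v)) := by
  set c : ℝ := 2 * a * √(Real.cosh (2 * u)) with hc
  set φ : ℝ := Real.arctan (Real.sinh u / Real.cosh u) with hφ
  have hcu := Real.cosh_pos u
  have hcpos : 0 < c := by have := Real.cosh_pos (2 * u); positivity
  have hsq : √(1 + (Real.sinh u / Real.cosh u) ^ 2) = √(Real.cosh (2 * u)) / Real.cosh u := by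
    rw [← Real.sqrt_sq hcu.le, ← Real.sqrt_div (Real.cosh_pos _).le, Real.sqrt_sq hcu.le,
      Real.cosh_two_mul]
    congr 1
    field_simp
  have hsqpos : 0 < √(Real.cosh (2 * u)) := Real.sqrt_pos.2 (Real.cosh_pos _)
  have hcos : c * Real.cos φ = 2 * a * Real.cosh u := by
    rw [hφ, Real.cos_arctan, hsq, hc]
    field_simp
  have hsin : c * Real.sin φ = 2 * a * Real.sinh u := by
    rw [hφ, Real.sin_arctan, hsq, hc]
    field_simp
  have key : ∀ v : ℝ, (Complex.exp (-(a * (1 + Complex.I)) * (Real.cosh (u + v) : ℂ)) *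
        Complex.exp (2 * Complex.I * (τ : ℂ) * ((u + v : ℝ) : ℂ))) *
      (Complex.exp (-(a * (1 - Complex.I)) * (Real.cosh (u - v) : ℂ)) *
        Complex.exp (2 * Complex.I * (τ : ℂ) * ((u - v : ℝ) : ℂ))) =
      Complex.exp (((4 * τ * u : ℝ) : ℂ) * Complex.I) *
        Complex.exp (-c * Complex.cosh (v + φ * Complex.I)) := by
    intro v
    have hcos' : (c : ℂ) * Real.cos φ = 2 * a * Real.cosh u := mod_cast hcos
    have hsin' : (c : ℂ) * Real.sin φ = 2 * a * Real.sinh u := mod_cast hsin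
    rw [cosh_add_mul_I_eq, Real.cosh_add, Real.cosh_sub]
    simp only [← Complex.exp_add]
    congr 1
    simp only [Complex.ofReal_mul, Complex.ofReal_add, Complex.ofReal_sub, Complex.ofReal_ofNat]
    linear_combination (Real.cosh v : ℂ) * hcos' + (Real.sinh v : ℂ) * Complex.I * hsin'
  simp only [key]
  rw [integral_const_mul, integral_exp_neg_mul_cosh_add_mul_I hcpos
    ⟨Real.neg_pi_div_two_lt_arctan _, Real.arctan_lt_pi_div_two _⟩, enorm_mul]
  have h1 : ‖Complex.exp (((4 * τ * u : ℝ) : ℂ) * Complex.I)‖ₑ = 1 := by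
    rw [← ofReal_norm, Complex.norm_exp_ofReal_mul_I, ENNReal.ofReal_one]
  rw [h1, one_mul]
  refine (enorm_integral_le_lintegral_enorm _).trans (lintegral_mono fun v => ?_)
  have h := norm_exp_neg_mul_cosh_add_mul_I c v 0
  rw [← ofReal_norm]
  simp only [Complex.ofReal_zero, zero_mul, add_zero, Real.cos_zero, mul_one] at h
  rw [h]

lemma enorm_besselK_mul_besselK_le {a : ℝ} (ha : 0 < a) (τ : ℝ) :
    ‖besselK (2 * Complex.I * (τ : ℂ)) (a * (1 + Complex.I)) *
      besselK (2 * Complex.I * (τ : ℂ)) (a * (1 - Complex.I))‖ₑ ≤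
    2⁻¹ * ∫⁻ u : ℝ, ∫⁻ v : ℝ,
      ENNReal.ofReal (Real.exp (-(2 * a * √(Real.cosh (2 * u))) * Real.cosh v)) := by
  have hz : 0 < ((a : ℂ) * (1 + Complex.I)).re := by simpa using ha
  have hw : 0 < ((a : ℂ) * (1 - Complex.I)).re := by simpa using ha
  have h := integral_mul_integral_eq_two_mul (integrable_exp_neg_mul_cosh_mul_exp hz τ)
    (integrable_exp_neg_mul_cosh_mul_exp hw τ) (by fun_prop) (by fun_prop)
  rw [← two_mul_besselK hz, ← two_mul_besselK hw] at h
  have h' : ∀ A B X : ℂ, 2 * A * (2 * B) = 2 * X → A * B = 2⁻¹ * X := fun A B X hX => by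
    linear_combination hX / 4
  rw [h' _ _ _ h, enorm_mul]
  have h2 : ‖(2⁻¹ : ℂ)‖ₑ = 2⁻¹ := by
    rw [← ofReal_norm, norm_inv, Complex.norm_two, ENNReal.ofReal_inv_of_pos two_pos,
      ENNReal.ofReal_ofNat]
  rw [h2]
  gcongr
  exact (enorm_integral_le_lintegral_enorm _).trans
    (lintegral_mono fun u => enorm_integral_exp_neg_le ha τ u)

lemma kernelK_eq_re {x : ℝ} (hx : 0 ≤ x) (τ : ℝ) :
    kernelK x τ = (besselK (2 * Complex.I * (τ : ℂ))
        ((2 * x ^ ((1 : ℝ) / 4) : ℝ) * (1 + Complex.I)) *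
      besselK (2 * Complex.I * (τ : ℂ)) ((2 * x ^ ((1 : ℝ) / 4) : ℝ) * (1 - Complex.I))).re := by
  have h4 : ((4 : ℝ) * x) ^ ((1 : ℝ) / 4) = √2 * x ^ ((1 : ℝ) / 4) := by
    rw [Real.mul_rpow (by norm_num) hx, Real.sqrt_eq_rpow,
      show (4 : ℝ) = 2 ^ (2 : ℝ) by norm_num, ← Real.rpow_mul (by norm_num)]
    norm_num
  have hs : (√2 : ℂ) * √2 = 2 := by
    rw [← Complex.ofReal_mul, Real.mul_self_sqrt (by norm_num), Complex.ofReal_ofNat]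
  have he : Complex.exp (Complex.I * Real.pi / 4) = √2 / 2 * (1 + Complex.I) := by
    rw [show Complex.I * Real.pi / 4 = ((Real.pi / 4 : ℝ) : ℂ) * Complex.I by push_cast; ring,
      Complex.exp_mul_I, ← Complex.ofReal_cos, ← Complex.ofReal_sin, Real.cos_pi_div_four,
      Real.sin_pi_div_four]
    push_cast
    ring
  have he' : Complex.exp (-(Complex.I * Real.pi) / 4) = √2 / 2 * (1 - Complex.I) := by
    rw [show -(Complex.I * Real.pi) / 4 = ((-(Real.pi / 4) : ℝ) : ℂ) * Complex.I by
      push_cast; ring, Complex.exp_mul_I, ← Complex.ofReal_cos, ← Complex.ofReal_sin,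
      Real.cos_neg, Real.sin_neg, Real.cos_pi_div_four, Real.sin_pi_div_four]
    push_cast
    ring
  rw [kernelK, he, he', h4]
  congr 3
  · push_cast
    linear_combination (x ^ ((1 : ℝ) / 4) : ℝ) * (1 + Complex.I) * hs
  · push_cast
    linear_combination (x ^ ((1 : ℝ) / 4) : ℝ) * (1 - Complex.I) * hs

/-- A majorant of `kernelK x τ` that does not depend on `τ`. -/
lemma enorm_kernelK_le {x : ℝ} (hx : 0 < x) (τ : ℝ) :
    ‖kernelK x τ‖ₑ ≤ 2⁻¹ * ∫⁻ u : ℝ, ∫⁻ v : ℝ, ENNReal.ofReal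
      (Real.exp (-(4 * x ^ ((1 : ℝ) / 4) * √(Real.cosh (2 * u))) * Real.cosh v)) := by
  have h := enorm_besselK_mul_besselK_le (a := 2 * x ^ ((1 : ℝ) / 4)) (by positivity) τ
  rw [kernelK_eq_re hx.le]
  refine le_trans ?_ (h.trans_eq ?_)
  · rw [← ofReal_norm, ← ofReal_norm]
    exact ENNReal.ofReal_le_ofReal (Complex.abs_re_le_norm _)
  · simp only [← mul_assoc]
    norm_num

lemma norm_exp_neg_mul_cosh_mul_cosh_le (z : ℂ) (τ t : ℝ) :
    ‖Complex.exp (-z * (Real.cosh t : ℂ)) * Complex.cosh (2 * Complex.I * (τ : ℂ) * (t : ℂ))‖ ≤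
      Real.exp (-z.re * Real.cosh t) := by
  rw [norm_mul, Complex.norm_exp, show 2 * Complex.I * (τ : ℂ) * (t : ℂ) =
    ((2 * τ * t : ℝ) : ℂ) * Complex.I by push_cast; ring, Complex.cosh_mul_I,
    ← Complex.ofReal_cos, Complex.norm_real, Real.norm_eq_abs]
  have h : (-z * (Real.cosh t : ℂ)).re = -z.re * Real.cosh t := by simp
  rw [h]
  exact mul_le_of_le_one_right (Real.exp_pos _).le (Real.abs_cos_le_one _)

lemma continuous_besselK {z : ℂ} (hz : 0 < z.re) :
    Continuous fun τ : ℝ => besselK (2 * Complex.I * (τ : ℂ)) z := by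
  refine continuous_of_dominated (fun τ => Continuous.aestronglyMeasurable (by fun_prop))
    (fun τ => Eventually.of_forall fun t => norm_exp_neg_mul_cosh_mul_cosh_le z τ t)
    (integrable_exp_neg_mul_cosh hz).integrableOn (Eventually.of_forall fun t => by fun_prop)

lemma continuous_kernelK {x : ℝ} (hx : 0 < x) : Continuous (kernelK x) := by
  have hx' : 0 < x ^ ((1 : ℝ) / 4) := by positivity
  have h : kernelK x = fun τ => _ := funext fun τ => kernelK_eq_re hx.le τ
  rw [h]
  exact Complex.continuous_re.comp ((continuous_besselK (by simpa using hx')).mul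
    (continuous_besselK (by simpa using hx')))

lemma measurable_besselK_comp (nu : ℂ) {g : ℝ → ℂ} (hg : Measurable g) :
    Measurable fun x : ℝ => besselK nu (g x) := by
  refine (StronglyMeasurable.integral_prod_right (ν := volume.restrict (Ioi 0))
    (f := fun x t : ℝ => Complex.exp (-g x * (Real.cosh t : ℂ)) * Complex.cosh (nu * (t : ℂ)))
    (Measurable.stronglyMeasurable ?_)).measurable
  fun_prop

lemma measurable_kernelK (τ : ℝ) : Measurable fun x => kernelK x τ := by
  unfold kernelK
  refine Complex.measurable_re.comp ((measurable_besselK_comp _ ?_).mul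
    (measurable_besselK_comp _ ?_)) <;> fun_prop

/-- The integral over the line of a negative power of `cosh`, in terms of the beta function. -/
lemma lintegral_cosh_rpow {α k : ℝ} (hα : 0 < α) (hk : 0 < k) :
    ∫⁻ v : ℝ, ENNReal.ofReal (Real.cosh (k * v) ^ (-(2 * α))) =
      ENNReal.ofReal (2 ^ (2 * α - 1) / k * betaFn α α) := by
  have hβ : 0 < betaFn α α := ProbabilityTheory.beta_pos hα hα
  have himg : (fun v : ℝ => Real.sigmoid (2 * k * v)) '' univ = Ioo 0 1 := by
    rw [image_univ, ← Real.range_sigmoid]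
    exact (mul_left_surjective₀ (show 2 * k ≠ 0 by positivity)).range_comp Real.sigmoid
  have hder : ∀ v ∈ (univ : Set ℝ), HasDerivWithinAt (fun v : ℝ => Real.sigmoid (2 * k * v))
      (Real.sigmoid (2 * k * v) * (1 - Real.sigmoid (2 * k * v)) * (2 * k)) univ v := by
    intro v _
    refine HasDerivAt.hasDerivWithinAt ?_
    have h1 : HasDerivAt (fun v : ℝ => 2 * k * v) (2 * k) v := by
      simpa using (hasDerivAt_id v).const_mul (2 * k)
    exact (Real.hasDerivAt_sigmoid _).comp v h1
  have hinj : InjOn (fun v : ℝ => Real.sigmoid (2 * k * v)) univ :=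
    (Real.sigmoid_injective.comp (mul_right_injective₀ (show 2 * k ≠ 0 by positivity))).injOn
  have h1 : ∫⁻ x in Ioo (0 : ℝ) 1,
      ENNReal.ofReal (1 / betaFn α α * x ^ (α - 1) * (1 - x) ^ (α - 1)) = 1 :=
    ProbabilityTheory.lintegral_betaPDF.symm.trans
      (ProbabilityTheory.lintegral_betaPDF_eq_one hα hα)
  rw [← himg, lintegral_image_eq_lintegral_abs_deriv_mul MeasurableSet.univ hder hinj,
    Measure.restrict_univ] at h1
  have hpt : ∀ v : ℝ, ENNReal.ofReal
        |Real.sigmoid (2 * k * v) * (1 - Real.sigmoid (2 * k * v)) * (2 * k)| *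
      ENNReal.ofReal (1 / betaFn α α * Real.sigmoid (2 * k * v) ^ (α - 1) *
        (1 - Real.sigmoid (2 * k * v)) ^ (α - 1)) =
      ENNReal.ofReal (k / (2 ^ (2 * α - 1) * betaFn α α)) *
        ENNReal.ofReal (Real.cosh (k * v) ^ (-(2 * α))) := by
    intro v
    have hs0 := Real.sigmoid_pos (2 * k * v)
    have hs1 : 0 < 1 - Real.sigmoid (2 * k * v) := sub_pos.2 (Real.sigmoid_lt_one _)
    have hc := Real.cosh_pos (k * v)
    have hprod : Real.sigmoid (2 * k * v) * (1 - Real.sigmoid (2 * k * v)) =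
        (2 * Real.cosh (k * v)) ^ (-2 : ℝ) := by
      rw [← Real.sigmoid_neg, Real.sigmoid_def, Real.sigmoid_def, neg_neg, Real.cosh_eq,
        Real.rpow_neg (by positivity), Real.rpow_two, ← mul_inv]
      congr 1
      have e1 : Real.exp (2 * k * v) = Real.exp (k * v) ^ 2 := by
        rw [← Real.exp_nat_mul]; push_cast; ring_nf
      have e2 : Real.exp (-(2 * k * v)) = Real.exp (-(k * v)) ^ 2 := by
        rw [← Real.exp_nat_mul]; push_cast; ring_nf
      have e3 : Real.exp (k * v) * Real.exp (-(k * v)) = 1 := by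
        rw [← Real.exp_add, add_neg_cancel, Real.exp_zero]
      rw [e1, e2]
      linear_combination (Real.exp (k * v) * Real.exp (-(k * v)) - 1) * e3
    rw [← ENNReal.ofReal_mul (abs_nonneg _), ← ENNReal.ofReal_mul (by positivity)]
    congr 1
    rw [abs_of_pos (by positivity), mul_assoc (1 / betaFn α α), ← Real.mul_rpow hs0.le hs1.le,
      hprod]
    have e : (2 * Real.cosh (k * v)) ^ (-2 : ℝ) * ((2 * Real.cosh (k * v)) ^ (-2 : ℝ)) ^ (α - 1) =
        2 ^ (-(2 * α)) * Real.cosh (k * v) ^ (-(2 * α)) := by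
      rw [← Real.mul_rpow two_pos.le hc.le, ← Real.rpow_mul (by positivity),
        ← Real.rpow_add (by positivity)]
      congr 1
      ring
    have e2 : (2 : ℝ) ^ (-(2 * α)) = (2 * 2 ^ (2 * α - 1))⁻¹ := by
      rw [Real.rpow_neg two_pos.le, Real.rpow_sub two_pos, Real.rpow_one]
      congr 1
      field_simp
    calc _ = (2 * k / betaFn α α) * ((2 * Real.cosh (k * v)) ^ (-2 : ℝ) *
          ((2 * Real.cosh (k * v)) ^ (-2 : ℝ)) ^ (α - 1)) := by ring
      _ = _ := by
        rw [e, e2]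
        field_simp
  simp only [hpt] at h1
  rw [lintegral_const_mul' _ _ ENNReal.ofReal_ne_top] at h1
  rw [ENNReal.eq_inv_of_mul_eq_one_left ((mul_comm _ _).trans h1),
    ← ENNReal.ofReal_inv_of_pos (by positivity)]
  congr 1
  field_simp

lemma lintegral_rpow_mul_exp_neg_mul_rpow {p q b : ℝ} (hp : 0 < p) (hq : -1 < q) (hb : 0 < b) :
    ∫⁻ x in Ioi (0 : ℝ), ENNReal.ofReal (x ^ q * Real.exp (-b * x ^ p)) =
      ENNReal.ofReal (b ^ (-(q + 1) / p) * (1 / p) * Real.Gamma ((q + 1) / p)) := by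
  have hΓ : 0 < Real.Gamma ((q + 1) / p) :=
    Real.Gamma_pos_of_pos (div_pos (by linarith) hp)
  have hi := integral_rpow_mul_exp_neg_mul_rpow hp hq hb
  rw [← hi, ofReal_integral_eq_lintegral_ofReal]
  · exact not_imp_comm.1 integral_undef (by rw [hi]; positivity)
  · exact ae_restrict_of_forall_mem measurableSet_Ioi fun x hx => by
      have : (0 : ℝ) < x := hx
      positivity

lemma Lnorm_nonneg (ν p : ℝ) (f : ℝ → ℝ) : 0 ≤ Lnorm ν p f :=
  Real.rpow_nonneg (setIntegral_nonneg measurableSet_Ioi fun x hx => by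
    have : (0 : ℝ) < x := hx
    positivity) _

lemma betaFn_pos {a b : ℝ} (ha : 0 < a) (hb : 0 < b) : 0 < betaFn a b :=
  ProbabilityTheory.beta_pos ha hb

lemma lintegral_mul_exp_neg_le {p q ν : ℝ} (hpq : p.HolderConjugate q) (hν : ν < 1)
    {f : ℝ → ℝ} (hf : Measurable f)
    (hfin : IntegrableOn (fun x => |f x| ^ p * x ^ (ν * p - 1)) (Ioi 0)) {k : ℝ} (hk : 0 < k) :
    ∫⁻ x in Ioi (0 : ℝ), ‖f x‖ₑ * ENNReal.ofReal (Real.exp (-k * x ^ ((1 : ℝ) / 4))) ≤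
      ENNReal.ofReal (Lnorm ν p f * ((4 * Real.Gamma (4 * (1 - ν) * q)) ^ (1 / q) *
        (k * q) ^ (-(4 * (1 - ν))))) := by
  have hp0 := hpq.pos
  have hq0 := hpq.symm.pos
  have hsum : 1 / p + 1 / q = 1 := by simpa using hpq.inv_add_inv_eq_one
  have hmul : p + q = p * q := by field_simp at hsum; linarith
  have ha : 0 < 1 - ν := by linarith
  calc _ = ∫⁻ x in Ioi (0 : ℝ), ((fun x => ENNReal.ofReal (|f x| * x ^ (ν - 1 / p))) *
        fun x => ENNReal.ofReal (x ^ (1 / p - ν) * Real.exp (-k * x ^ ((1 : ℝ) / 4)))) x := by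
        refine setLIntegral_congr_fun measurableSet_Ioi fun x hx => ?_
        have hx0 : (0 : ℝ) < x := hx
        rw [Pi.mul_apply, ← ENNReal.ofReal_mul (by positivity), ← ofReal_norm,
          ← ENNReal.ofReal_mul (norm_nonneg _), Real.norm_eq_abs]
        congr 1
        have : x ^ (ν - 1 / p) * x ^ (1 / p - ν) = 1 := by
          rw [← Real.rpow_add hx0, show ν - 1 / p + (1 / p - ν) = 0 by ring, Real.rpow_zero]
        linear_combination (-|f x| * Real.exp (-k * x ^ ((1 : ℝ) / 4))) * this
    _ ≤ _ := ENNReal.lintegral_mul_le_Lp_mul_Lq _ hpq (by fun_prop) (by fun_prop)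
    _ = ENNReal.ofReal (Lnorm ν p f) * ENNReal.ofReal
        ((4 * Real.Gamma (4 * (1 - ν) * q)) ^ (1 / q) * (k * q) ^ (-(4 * (1 - ν)))) := by
        congr 1
        · have h0 : ∀ᵐ x ∂volume.restrict (Ioi (0 : ℝ)),
              0 ≤ |f x| ^ p * x ^ (ν * p - 1) :=
            ae_restrict_of_forall_mem measurableSet_Ioi fun x hx => by
              have : (0 : ℝ) < x := hx
              positivity
          rw [Lnorm, ← ENNReal.ofReal_rpow_of_nonneg (integral_nonneg_of_ae h0) (by positivity),
            ofReal_integral_eq_lintegral_ofReal hfin h0]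
          congr 1
          refine setLIntegral_congr_fun measurableSet_Ioi fun x hx => ?_
          have hx0 : (0 : ℝ) < x := hx
          rw [ENNReal.ofReal_rpow_of_nonneg (by positivity) hp0.le,
            Real.mul_rpow (abs_nonneg _) (by positivity), ← Real.rpow_mul hx0.le]
          congr 3
          field_simp
        · have hΓ : 0 < Real.Gamma (4 * (1 - ν) * q) := Real.Gamma_pos_of_pos (by positivity)
          have h1 := lintegral_rpow_mul_exp_neg_mul_rpow (p := 1 / 4) (q := (1 - ν) * q - 1)
            (b := k * q) (by norm_num) (by nlinarith [mul_pos ha hq0]) (by positivity)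
          have h2 : ∫⁻ x in Ioi (0 : ℝ), ENNReal.ofReal
              (x ^ (1 / p - ν) * Real.exp (-k * x ^ ((1 : ℝ) / 4))) ^ q =
              ENNReal.ofReal (4 * Real.Gamma (4 * (1 - ν) * q) *
                (k * q) ^ (-(4 * (1 - ν)) * q)) := by
            trans ENNReal.ofReal ((k * q) ^ (-((1 - ν) * q - 1 + 1) / (1 / 4)) * (1 / (1 / 4)) *
              Real.Gamma (((1 - ν) * q - 1 + 1) / (1 / 4)))
            · rw [← h1]
              refine setLIntegral_congr_fun measurableSet_Ioi fun x hx => ?_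
              have hx0 : (0 : ℝ) < x := hx
              rw [ENNReal.ofReal_rpow_of_nonneg (by positivity) hq0.le,
                Real.mul_rpow (by positivity) (Real.exp_pos _).le, ← Real.rpow_mul hx0.le,
                ← Real.exp_mul]
              congr 3
              · field_simp
                linear_combination hmul
              · ring
            · congr 1
              rw [show -((1 - ν) * q - 1 + 1) / (1 / 4) = -(4 * (1 - ν)) * q by ring,
                show ((1 - ν) * q - 1 + 1) / (1 / 4) = 4 * (1 - ν) * q by ring]
              ring
          rw [h2, ENNReal.ofReal_rpow_of_nonneg (by positivity) (by positivity),
            Real.mul_rpow (by positivity) (by positivity), ← Real.rpow_mul (by positivity)]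
          congr 3
          field_simp
    _ = _ := by
        rw [← ENNReal.ofReal_mul (Lnorm_nonneg ν p f)]

lemma lintegral_mul_majorant_le {p q ν : ℝ} (hpq : p.HolderConjugate q) (hν : ν < 1)
    {f : ℝ → ℝ} (hf : Measurable f)
    (hfin : IntegrableOn (fun x => |f x| ^ p * x ^ (ν * p - 1)) (Ioi 0)) :
    ∫⁻ x in Ioi (0 : ℝ), ‖f x‖ₑ * (2⁻¹ * ∫⁻ u : ℝ, ∫⁻ v : ℝ, ENNReal.ofReal
      (Real.exp (-(4 * x ^ ((1 : ℝ) / 4) * √(Real.cosh (2 * u))) * Real.cosh v))) ≤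
    ENNReal.ofReal ((4 : ℝ) ^ (ν - 3 + 1 / q) * q ^ (4 * (ν - 1)) *
      (Real.Gamma (4 * (1 - ν) * q)) ^ (1 / q) * betaFn (1 - ν) (1 - ν) *
      betaFn (2 * (1 - ν)) (2 * (1 - ν)) * Lnorm ν p f) := by
  have hq0 := hpq.symm.pos
  have ha : 0 < 1 - ν := by linarith
  have hΓ : 0 < Real.Gamma (4 * (1 - ν) * q) := Real.Gamma_pos_of_pos (by positivity)
  have hL := Lnorm_nonneg ν p f
  have hβ1 : 0 < betaFn (1 - ν) (1 - ν) := betaFn_pos ha ha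
  set E : ℝ → ℝ → ℝ → ENNReal := fun x u v => ‖f x‖ₑ * ENNReal.ofReal
      (Real.exp (-(4 * x ^ ((1 : ℝ) / 4) * √(Real.cosh (2 * u))) * Real.cosh v)) with hE
  have hEm : Measurable fun z : (ℝ × ℝ) × ℝ => E z.1.1 z.1.2 z.2 := by
    rw [hE]
    fun_prop
  obtain ⟨A, hA⟩ : ∃ A : ℝ, A = Lnorm ν p f *
    ((4 * Real.Gamma (4 * (1 - ν) * q)) ^ (1 / q) * (4 * q) ^ (-(4 * (1 - ν)))) := ⟨_, rfl⟩
  have hA0 : 0 ≤ A := by rw [hA]; positivity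
  have hin : ∀ u v : ℝ, ∫⁻ x in Ioi (0 : ℝ), E x u v ≤
      ENNReal.ofReal A * ENNReal.ofReal (Real.cosh (2 * u) ^ (-(2 * (1 - ν)))) *
        ENNReal.ofReal (Real.cosh (1 * v) ^ (-(2 * (2 * (1 - ν))))) := by
    intro u v
    have hu := Real.cosh_pos (2 * u)
    have hv := Real.cosh_pos v
    have hk : 0 < 4 * √(Real.cosh (2 * u)) * Real.cosh v := by positivity
    refine (le_of_eq ?_).trans ((lintegral_mul_exp_neg_le hpq hν hf hfin hk).trans_eq ?_)
    · refine lintegral_congr fun x => ?_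
      simp only [hE]
      congr 3
      ring
    · rw [← ENNReal.ofReal_mul hA0, ← ENNReal.ofReal_mul (by positivity), hA, one_mul,
        show 4 * √(Real.cosh (2 * u)) * Real.cosh v * q =
          4 * q * (√(Real.cosh (2 * u)) * Real.cosh v) by ring,
        Real.mul_rpow (x := 4 * q) (by positivity) (by positivity),
        Real.mul_rpow (x := √(Real.cosh (2 * u))) (Real.sqrt_nonneg _) hv.le, Real.sqrt_eq_rpow,
        ← Real.rpow_mul hu.le]
      ring_nf
  calc _ = 2⁻¹ * ∫⁻ x in Ioi (0 : ℝ), ∫⁻ u : ℝ, ∫⁻ v : ℝ, E x u v := by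
        rw [← lintegral_const_mul' _ _ (by simp)]
        refine lintegral_congr fun x => ?_
        simp only [hE]
        simp_rw [lintegral_const_mul' _ _ enorm_ne_top]
        ring
    _ = 2⁻¹ * ∫⁻ u : ℝ, ∫⁻ v : ℝ, ∫⁻ x in Ioi (0 : ℝ), E x u v := by
        rw [lintegral_lintegral_swap (Measurable.lintegral_prod_right' hEm).aemeasurable]
        congr 1
        refine lintegral_congr fun u => lintegral_lintegral_swap (Measurable.aemeasurable ?_)
        exact hEm.comp (f := fun z : ℝ × ℝ => ((z.1, u), z.2)) (by fun_prop)
    _ ≤ 2⁻¹ * ∫⁻ u : ℝ, ∫⁻ v : ℝ, ENNReal.ofReal A *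
          ENNReal.ofReal (Real.cosh (2 * u) ^ (-(2 * (1 - ν)))) *
          ENNReal.ofReal (Real.cosh (1 * v) ^ (-(2 * (2 * (1 - ν))))) := by
        gcongr with u v
        exact hin u v
    _ = ENNReal.ofReal (2⁻¹ * (A * (2 ^ (2 * (1 - ν) - 1) / 2 * betaFn (1 - ν) (1 - ν)) *
          (2 ^ (2 * (2 * (1 - ν)) - 1) / 1 * betaFn (2 * (1 - ν)) (2 * (1 - ν))))) := by
        simp_rw [lintegral_const_mul' _ _
          (ENNReal.mul_ne_top ENNReal.ofReal_ne_top ENNReal.ofReal_ne_top)]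
        rw [lintegral_cosh_rpow (by positivity) one_pos,
          lintegral_mul_const' _ _ ENNReal.ofReal_ne_top,
          lintegral_const_mul' _ _ ENNReal.ofReal_ne_top, lintegral_cosh_rpow ha two_pos,
          ENNReal.ofReal_mul (p := 2⁻¹) (by positivity),
          ENNReal.ofReal_mul (p := A * _) (by positivity), ENNReal.ofReal_mul hA0, ENNReal.ofReal_inv_of_pos two_pos, ENNReal.ofReal_ofNat]
    _ = _ := by
        congr 1
        have h4 : ∀ r : ℝ, (4 : ℝ) ^ r = 2 ^ (2 * r) := fun r => by
          rw [Real.rpow_mul two_pos.le]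
          norm_num
        have hpow : (2⁻¹ : ℝ) * 2⁻¹ * (4 ^ (1 / q) * 4 ^ (-(4 * (1 - ν)))) *
            (2 ^ (2 * (1 - ν) - 1) * 2 ^ (2 * (2 * (1 - ν)) - 1)) = 4 ^ (ν - 3 + 1 / q) := by
          rw [h4, h4, h4, ← Real.rpow_neg_one 2, ← Real.rpow_add two_pos, ← Real.rpow_add two_pos,
            ← Real.rpow_add two_pos, ← Real.rpow_add two_pos, ← Real.rpow_add two_pos]
          congr 1
          ring
        rw [hA, Real.mul_rpow (by norm_num) hΓ.le, Real.mul_rpow (by norm_num) hq0.le,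
          show 4 * (ν - 1) = -(4 * (1 - ν)) by ring]
        linear_combination (Lnorm ν p f * Real.Gamma (4 * (1 - ν) * q) ^ (1 / q) *
          q ^ (-(4 * (1 - ν))) * betaFn (1 - ν) (1 - ν) *
          betaFn (2 * (1 - ν)) (2 * (1 - ν))) * hpow

/-- Theorem 2 (boundedness of the index transform (1.1)). -/
theorem indexF_bounded (p q ν : ℝ) (hp : 1 < p) (hq : q = p/(p-1)) (hν : ν < 1)
    (f : ℝ → ℝ) (hf : Measurable f)
    (hfin : MeasureTheory.IntegrableOn (fun x => |f x| ^ p * x ^ (ν*p - 1)) (Set.Ioi 0)) :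
    (∀ τ : ℝ, 0 ≤ τ → MeasureTheory.IntegrableOn (fun x => kernelK x τ * f x) (Set.Ioi 0)) ∧
    ContinuousOn (indexF f) (Set.Ici 0) ∧
    (∀ τ : ℝ, 0 ≤ τ →
      |indexF f τ| ≤ (4:ℝ)^(ν - 3 + 1/q) * q^(4*(ν-1)) * (Real.Gamma (4*(1-ν)*q))^(1/q)
        * betaFn (1-ν) (1-ν) * betaFn (2*(1-ν)) (2*(1-ν)) * Lnorm ν p f) := by
  have hpq : p.HolderConjugate q := by
    rw [hq]
    exact Real.HolderConjugate.conjExponent hp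
  set M : ℝ → ENNReal := fun x => ‖f x‖ₑ * (2⁻¹ * ∫⁻ u : ℝ, ∫⁻ v : ℝ, ENNReal.ofReal
      (Real.exp (-(4 * x ^ ((1 : ℝ) / 4) * √(Real.cosh (2 * u))) * Real.cosh v))) with hM
  have hMle := lintegral_mul_majorant_le hpq hν hf hfin
  have hMm : Measurable M := by
    refine (by fun_prop : Measurable fun x => ‖f x‖ₑ).mul (Measurable.const_mul ?_ _)
    refine Measurable.lintegral_prod_right'
      (f := fun z : ℝ × ℝ => ∫⁻ v : ℝ, ENNReal.ofReal (Real.exp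
        (-(4 * z.1 ^ ((1 : ℝ) / 4) * √(Real.cosh (2 * z.2))) * Real.cosh v))) ?_
    refine Measurable.lintegral_prod_right'
      (f := fun z : (ℝ × ℝ) × ℝ => ENNReal.ofReal (Real.exp
        (-(4 * z.1.1 ^ ((1 : ℝ) / 4) * √(Real.cosh (2 * z.1.2))) * Real.cosh z.2))) ?_
    fun_prop
  have hMtop : ∫⁻ x in Ioi (0 : ℝ), M x ≠ ⊤ := ne_top_of_le_ne_top ENNReal.ofReal_ne_top hMle
  have hkM : ∀ τ : ℝ, ∀ x ∈ Ioi (0 : ℝ), ‖kernelK x τ * f x‖ₑ ≤ M x := fun τ x hx => by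
    rw [enorm_mul, mul_comm]
    exact mul_le_mul_right (enorm_kernelK_le hx τ) _
  have hmeas : ∀ τ : ℝ, Measurable fun x => kernelK x τ * f x :=
    fun τ => (measurable_kernelK τ).mul hf
  have hle : ∀ τ : ℝ, ∫⁻ x in Ioi (0 : ℝ), ‖kernelK x τ * f x‖ₑ ≤ ∫⁻ x in Ioi (0 : ℝ), M x :=
    fun τ => setLIntegral_mono hMm (hkM τ)
  refine ⟨fun τ _ => ⟨(hmeas τ).aestronglyMeasurable, (hle τ).trans_lt hMtop.lt_top⟩, ?_, ?_⟩
  · refine continuousOn_of_dominated (bound := fun x => (M x).toReal)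
      (fun τ _ => (hmeas τ).aestronglyMeasurable) (fun τ _ => ?_)
      (integrable_toReal_of_lintegral_ne_top hMm.aemeasurable hMtop) ?_
    · filter_upwards [ae_lt_top hMm hMtop, ae_restrict_mem measurableSet_Ioi] with x hxM hx
      rw [← toReal_enorm]
      exact ENNReal.toReal_mono hxM.ne (hkM τ x hx)
    · exact ae_restrict_of_forall_mem measurableSet_Ioi fun x hx =>
        ((continuous_kernelK hx).mul continuous_const).continuousOn
  · intro τ _
    have h := (enorm_integral_le_lintegral_enorm _).trans ((hle τ).trans hMle)
    rw [← ofReal_norm, Real.norm_eq_abs] at h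
    refine (ENNReal.ofReal_le_ofReal_iff ?_).1 h
    have ha : 0 < 1 - ν := by linarith
    have hq0 := hpq.symm.pos
    have hL := Lnorm_nonneg ν p f
    have hβ1 := betaFn_pos ha ha
    have hβ2 := betaFn_pos (mul_pos two_pos ha) (mul_pos two_pos ha)
    have hΓ : 0 < Real.Gamma (4 * (1 - ν) * q) := Real.Gamma_pos_of_pos (by positivity)
    positivity
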